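/- Let Λ be a finite simplicial graph and G_Λ the right-angled Artin group on Λ. If Λ is triangle-free, then for any two adjacent vertices a, b of Λ, the intersection of centralizers C(a) ∩ C(b) equals the free abelian subgroup ⟨a, b⟩ ≅ ℤ². -/

import Mathlib

/-- The commutator relators of a right-angled Artin group on the graph `Λ`. -/
def raagRels {V : Type*} (Λ : SimpleGraph V) : Set (FreeGroup V) :=
  {r | ∃ u v : V, Λ.Adj u v ∧
    r = FreeGroup.of u * FreeGroup.of v * (FreeGroup.of u)⁻¹ * (FreeGroup.of v)⁻¹}

/-- The right-angled Artin group on the graph `Λ`. -/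
abbrev RAAG {V : Type*} (Λ : SimpleGraph V) := PresentedGroup (raagRels Λ)

/-- The standard generator of the RAAG corresponding to a vertex. -/
def raagOf {V : Type*} (Λ : SimpleGraph V) (v : V) : RAAG Λ := PresentedGroup.of v

theorem freeGroup_of_commute_eq {α : Type*} {x y : α}
    (h : FreeGroup.of x * FreeGroup.of y = FreeGroup.of y * FreeGroup.of x) : x = y := by
  classical
  by_contra hne
  have h2 := congrArg FreeGroup.toWord h
  simp [FreeGroup.toWord_mul, FreeGroup.reduce.cons] at h2
  exact hne h2.1

/-- The centralizer of a generator in a free group consists of its powers. -/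
theorem freeGroup_centralizer {α : Type*} (x : α) (w : FreeGroup α)
    (h : w * FreeGroup.of x = FreeGroup.of x * w) : ∃ n : ℤ, w = FreeGroup.of x ^ n := by
  classical
  let H : Subgroup (FreeGroup α) := Subgroup.closure {w, FreeGroup.of x}
  have hcomm : ∀ p q : H, p * q = q * p := by
    have : IsMulCommutative H := by
      apply Subgroup.isMulCommutative_closure
      rintro p (rfl | rfl) q (rfl | rfl)
      · rfl
      · exact h
      · exact h.symm
      · rfl
    intro p q
    exact this.is_comm.comm p q
  let e : H ≃* FreeGroup (IsFreeGroup.Generators H) := IsFreeGroup.toFreeGroup H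
  have hsub : ∀ p q : IsFreeGroup.Generators H, p = q := by
    intro p q
    apply freeGroup_of_commute_eq
    apply e.symm.injective
    rw [map_mul, map_mul, hcomm]
  let w' : H := ⟨w, Subgroup.subset_closure (by simp)⟩
  let t' : H := ⟨FreeGroup.of x, Subgroup.subset_closure (by simp)⟩
  rcases isEmpty_or_nonempty (IsFreeGroup.Generators H) with hE | ⟨⟨c⟩⟩
  · refine ⟨0, ?_⟩
    have : w' = 1 := e.injective (Subsingleton.elim _ _)
    simpa [w'] using congrArg Subtype.val this
  · have key : ∀ u : FreeGroup (IsFreeGroup.Generators H), ∃ n : ℤ, u = FreeGroup.of c ^ n := by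
      intro u
      have : u ∈ Subgroup.zpowers (FreeGroup.of c) := by
        induction u using FreeGroup.induction_on with
        | C1 => exact one_mem _
        | of p => rw [hsub p c]; exact Subgroup.mem_zpowers _
        | inv_of p hp => exact inv_mem hp
        | mul p q hp hq => exact mul_mem hp hq
      obtain ⟨n, hn⟩ := this
      exact ⟨n, hn.symm⟩
    let d : FreeGroup α := (e.symm (FreeGroup.of c) : H)
    have key2 : ∀ u : H, ∃ n : ℤ, (u : FreeGroup α) = d ^ n := by
      intro u
      obtain ⟨n, hn⟩ := key (e u)
      refine ⟨n, ?_⟩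
      have : u = e.symm (FreeGroup.of c) ^ n := by
        rw [← map_zpow, ← hn]; simp
      simpa using congrArg Subtype.val this
    obtain ⟨m, hm⟩ := key2 w'
    obtain ⟨k, hk⟩ := key2 t'
    change w = d ^ m at hm
    change FreeGroup.of x = d ^ k at hk
    let s : FreeGroup α →* Multiplicative ℤ := FreeGroup.lift fun _ => Multiplicative.ofAdd 1
    have h1 : k * (s d).toAdd = 1 := by
      have := congrArg (fun z => (s z).toAdd) hk
      simpa [s] using this.symm
    rcases Int.eq_one_or_neg_one_of_mul_eq_one h1 with rfl | rfl
    · exact ⟨m, by rw [hm, hk, zpow_one]⟩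
    · exact ⟨-m, by rw [hm, hk]; simp⟩

/-- Homomorphisms out of a right-angled Artin group. -/
theorem raag_lift {V : Type*} (Λ : SimpleGraph V) {K : Type*} [Group K] (f : V → K)
    (hf : ∀ u v, Λ.Adj u v → f u * f v = f v * f u) :
    ∃ F : RAAG Λ →* K, ∀ v, F (raagOf Λ v) = f v := by
  refine ⟨PresentedGroup.toGroup (f := f) ?_, fun v => PresentedGroup.toGroup.of _⟩
  rintro r ⟨u, v, huv, rfl⟩
  simp [hf u v huv]

theorem raag_hom_ext {V : Type*} (Λ : SimpleGraph V) {K : Type*} [Group K] (F F' : RAAG Λ →* K)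
    (h : ∀ v, F (raagOf Λ v) = F' (raagOf Λ v)) (g : RAAG Λ) : F g = F' g :=
  DFunLike.congr_fun (PresentedGroup.ext h) g

theorem raag_comm {V : Type*} (Λ : SimpleGraph V) {u v : V} (h : Λ.Adj u v) :
    raagOf Λ u * raagOf Λ v = raagOf Λ v * raagOf Λ u := by
  have := PresentedGroup.one_of_mem (rels := raagRels Λ) ⟨u, v, h, rfl⟩
  simp only [map_mul, map_inv] at this
  change raagOf Λ u * raagOf Λ v * (raagOf Λ u)⁻¹ * (raagOf Λ v)⁻¹ = 1 at this
  rw [mul_inv_eq_one, mul_inv_eq_iff_eq_mul] at this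
  exact this

/-- The permutation action on the free group over a coset space. -/
def cosetAut {G : Type*} [Group G] (A : Subgroup G) : G →* MulAut (FreeGroup (G ⧸ A)) where
  toFun g := FreeGroup.freeGroupCongr (MulAction.toPerm g)
  map_one' := by
    apply MulEquiv.toMonoidHom_injective
    ext q
    simp
  map_mul' g h := by
    apply MulEquiv.toMonoidHom_injective
    ext q
    simp [mul_smul]

theorem cosetAut_of {G : Type*} [Group G] (A : Subgroup G) (g : G) (q : G ⧸ A) :
    cosetAut A g (FreeGroup.of q) = FreeGroup.of (g • q) := by
  simp [cosetAut]

theorem exists_retract {G : Type*} [Group G] (A : Subgroup G) (a : G)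
    (hA : ∀ x ∈ A, x * a = a * x) :
    ∃ ψ : (FreeGroup (G ⧸ A)) ⋊[cosetAut A] G →* G,
      (∀ g, ψ (SemidirectProduct.inr g) = g) ∧
      ψ (SemidirectProduct.inl (FreeGroup.of ((1 : G) : G ⧸ A))) = a := by
  let f : G ⧸ A → G := fun q => q.out * a * q.out⁻¹
  have hf : ∀ g : G, f (g : G ⧸ A) = g * a * g⁻¹ := by
    intro g
    obtain ⟨α, hα⟩ := QuotientGroup.mk_out_eq_mul A g
    have := hA α α.2
    simp only [f]
    rw [hα, mul_inv_rev, mul_assoc g, this]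
    group
  refine ⟨SemidirectProduct.lift (FreeGroup.lift f) (MonoidHom.id G) ?_, ?_, ?_⟩
  · intro g
    ext q
    induction q using QuotientGroup.induction_on with
    | H z =>
      have : g • (z : G ⧸ A) = ((g * z : G) : G ⧸ A) := rfl
      simp [cosetAut_of, this, hf, mul_assoc]
  · intro g; simp
  · simp [hf]

/-- Elements of the semidirect product commuting with the base generator. -/
theorem semidirect_centralizer {G : Type*} [Group G] (A : Subgroup G)
    (y : (FreeGroup (G ⧸ A)) ⋊[cosetAut A] G)
    (h : y * SemidirectProduct.inl (FreeGroup.of ((1 : G) : G ⧸ A)) =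
      SemidirectProduct.inl (FreeGroup.of ((1 : G) : G ⧸ A)) * y) :
    y.right ∈ A ∧ ∃ n : ℤ, y.left = FreeGroup.of ((1 : G) : G ⧸ A) ^ n := by
  have h1 := congrArg SemidirectProduct.left h
  simp only [SemidirectProduct.mul_left, SemidirectProduct.left_inl, SemidirectProduct.right_inl,
    map_one, MulAut.one_apply, cosetAut_of] at h1
  have h2 : y.right • ((1 : G) : G ⧸ A) = ((1 : G) : G ⧸ A) := by
    have := congrArg (FreeGroup.lift fun q => Multiplicative.ofAdd (FreeAbelianGroup.of q)) h1
    simp only [map_mul, FreeGroup.lift_apply_of] at this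
    rw [mul_comm, mul_right_cancel_iff] at this
    exact FreeAbelianGroup.of_injective (Multiplicative.ofAdd.injective this)
  refine ⟨?_, ?_⟩
  · have h3 : ((y.right * 1 : G) : G ⧸ A) = ((1 : G) : G ⧸ A) := h2
    rw [QuotientGroup.eq] at h3
    simpa using h3
  · rw [h2] at h1
    exact freeGroup_centralizer _ _ h1

/-- An element commuting with a standard generator `a` lies in `⟨a⟩ ⟨Lk a⟩`. -/
theorem raag_centralizer {V : Type*} (Λ : SimpleGraph V) (a : V) (g : RAAG Λ)
    (h : g * raagOf Λ a = raagOf Λ a * g) :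
    ∃ n : ℤ, ∃ k ∈ Subgroup.closure (raagOf Λ '' {v | Λ.Adj a v}), g = raagOf Λ a ^ n * k := by
  classical
  set A : Subgroup (RAAG Λ) := Subgroup.closure (raagOf Λ '' {v | Λ.Adj a v}) with hAdef
  have hA : ∀ x ∈ A, x * raagOf Λ a = raagOf Λ a * x := by
    intro x hx
    have : A ≤ Subgroup.centralizer {raagOf Λ a} := by
      rw [hAdef, Subgroup.closure_le]
      rintro _ ⟨v, hv, rfl⟩
      simp only [SetLike.mem_coe, Subgroup.mem_centralizer_singleton_iff]
      exact (raag_comm Λ hv).symm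
    exact Subgroup.mem_centralizer_singleton_iff.1 (this hx)
  obtain ⟨ψ, hψr, hψl⟩ := exists_retract A (raagOf Λ a) hA
  let t : (FreeGroup (RAAG Λ ⧸ A)) ⋊[cosetAut A] (RAAG Λ) :=
    SemidirectProduct.inl (FreeGroup.of ((1 : RAAG Λ) : RAAG Λ ⧸ A))
  have ht : ∀ v, Λ.Adj a v → SemidirectProduct.inr (raagOf Λ v) * t =
      t * SemidirectProduct.inr (raagOf Λ v) := by
    intro v hv
    ext
    · have : raagOf Λ v • ((1 : RAAG Λ) : RAAG Λ ⧸ A) = ((1 : RAAG Λ) : RAAG Λ ⧸ A) := by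
        change ((raagOf Λ v * 1 : RAAG Λ) : RAAG Λ ⧸ A) = ((1 : RAAG Λ) : RAAG Λ ⧸ A)
        rw [QuotientGroup.eq]
        have hmem : raagOf Λ v ∈ A := Subgroup.subset_closure ⟨v, hv, rfl⟩
        simpa using hmem
      simp [t, cosetAut_of, this]
    · simp [t]
  obtain ⟨φ, hφ⟩ := raag_lift Λ
    (fun v => if v = a then t else SemidirectProduct.inr (raagOf Λ v)) (by
      intro u v huv
      by_cases hu : u = a <;> by_cases hv : v = a
      · simp [hu, hv]
      · subst hu; simp only [if_true, hv, if_false]; exact (ht v huv).symm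
      · subst hv; simp only [if_true, hu, if_false]; exact ht u huv.symm
      · simp only [hu, hv, if_false, ← map_mul, raag_comm Λ huv])
  have hψφ : ∀ x, ψ (φ x) = x := by
    intro x
    refine raag_hom_ext Λ (ψ.comp φ) (MonoidHom.id _) (fun v => ?_) x
    by_cases hv : v = a
    · subst hv; simpa [hφ] using hψl
    · simp [hφ, hv, hψr]
  have hφa : φ (raagOf Λ a) = t := by simp [hφ]
  have hc := congrArg φ h
  rw [map_mul, map_mul, hφa] at hc
  obtain ⟨h1, n, hn⟩ := semidirect_centralizer A (φ g) hc
  refine ⟨n, (φ g).right, h1, ?_⟩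
  have h2 := SemidirectProduct.inl_left_mul_inr_right (φ g)
  rw [hn] at h2
  have h3 := congrArg ψ h2
  rw [hψφ, map_mul, map_zpow, map_zpow, hψl, hψr] at h3
  exact h3.symm

/-- If `Λ` is finite and triangle-free and `a, b` are adjacent
vertices, then in the RAAG `G_Λ` the intersection of centralizers
`C(a) ∩ C(b)` equals the subgroup `⟨a, b⟩`, which is free abelian `≅ ℤ²`. -/
theorem raag_centralizer_intersection {V : Type*} [Fintype V] (Λ : SimpleGraph V)
    (htri : Λ.CliqueFree 3) (a b : V) (hab : Λ.Adj a b) :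
    Subgroup.centralizer {raagOf Λ a} ⊓ Subgroup.centralizer {raagOf Λ b} =
      Subgroup.closure {raagOf Λ a, raagOf Λ b} ∧
    Nonempty ((Subgroup.closure {raagOf Λ a, raagOf Λ b} : Subgroup (RAAG Λ)) ≃*
      Multiplicative (ℤ × ℤ)) := by
  classical
  have hne : a ≠ b := hab.ne
  have hcomm := raag_comm Λ hab
  constructor
  · apply le_antisymm
    · rintro g ⟨hga, hgb⟩
      have hga' := Subgroup.mem_centralizer_singleton_iff.1 hga
      have hgb' := Subgroup.mem_centralizer_singleton_iff.1 hgb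
      obtain ⟨n, h, hh, rfl⟩ := raag_centralizer Λ a g hga'
      have hhb : h * raagOf Λ b = raagOf Λ b * h := by
        have hc : Commute (raagOf Λ a ^ n) (raagOf Λ b) := Commute.zpow_left hcomm n
        have h1 := hc.inv_left.mul_left (show Commute _ _ from hgb')
        simpa using h1.eq
      obtain ⟨m, k, hk, rfl⟩ := raag_centralizer Λ b h hhb
      obtain ⟨r, hr⟩ := raag_lift Λ (fun v => if Λ.Adj a v then raagOf Λ v else 1) (by
        intro u v huv
        by_cases hu : Λ.Adj a u <;> by_cases hv : Λ.Adj a v <;> simp [hu, hv, raag_comm Λ huv])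
      have hr1 : Subgroup.closure (raagOf Λ '' {v | Λ.Adj a v}) ≤
          r.eqLocus (MonoidHom.id _) := by
        rw [Subgroup.closure_le]
        rintro _ ⟨v, hv, rfl⟩
        change r (raagOf Λ v) = raagOf Λ v
        rw [hr]
        exact if_pos hv
      have hr2 : Subgroup.closure (raagOf Λ '' {v | Λ.Adj b v}) ≤ r.ker := by
        rw [Subgroup.closure_le]
        rintro _ ⟨v, hv, rfl⟩
        change r (raagOf Λ v) = 1
        rw [hr, if_neg]
        intro hv'
        exact htri {a, b, v} (SimpleGraph.is3Clique_triple_iff.2 ⟨hab, hv', hv⟩)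
      have e1 : r (raagOf Λ b ^ m * k) = raagOf Λ b ^ m * k := hr1 hh
      have e2 : r k = 1 := hr2 hk
      rw [map_mul, map_zpow, hr, if_pos hab, e2, mul_right_inj] at e1
      rw [← e1, mul_one]
      exact mul_mem (zpow_mem (Subgroup.subset_closure (by simp)) _)
        (zpow_mem (Subgroup.subset_closure (by simp)) _)
    · rw [Subgroup.closure_le]
      rintro _ (rfl | rfl)
      · exact ⟨Subgroup.mem_centralizer_singleton_iff.2 rfl,
          Subgroup.mem_centralizer_singleton_iff.2 hcomm⟩
      · exact ⟨Subgroup.mem_centralizer_singleton_iff.2 hcomm.symm,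
          Subgroup.mem_centralizer_singleton_iff.2 rfl⟩
  · obtain ⟨p, hp⟩ := raag_lift Λ (K := Multiplicative (ℤ × ℤ))
      (fun v => Multiplicative.ofAdd (if v = a then 1 else 0, if v = b then 1 else 0))
      (fun u v _ => mul_comm _ _)
    let q := p.comp (Subgroup.closure {raagOf Λ a, raagOf Λ b}).subtype
    have hval : ∀ m n : ℤ, p (raagOf Λ a ^ m * raagOf Λ b ^ n) =
        Multiplicative.ofAdd (m, n) := by
      intro m n
      rw [map_mul, map_zpow, map_zpow, hp, hp]
      apply Multiplicative.toAdd.injective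
      simp [hne, hne.symm]
    have hform : ∀ x ∈ Subgroup.closure {raagOf Λ a, raagOf Λ b},
        ∃ m n : ℤ, x = raagOf Λ a ^ m * raagOf Λ b ^ n := by
      intro x hx
      induction hx using Subgroup.closure_induction with
      | mem x hx =>
        rcases hx with rfl | rfl
        · exact ⟨1, 0, by simp⟩
        · exact ⟨0, 1, by simp⟩
      | one => exact ⟨0, 0, by simp⟩
      | mul x y _ _ hx hy =>
        obtain ⟨m, n, rfl⟩ := hx
        obtain ⟨m', n', rfl⟩ := hy
        refine ⟨m + m', n + n', ?_⟩
        have hc : Commute (raagOf Λ b ^ n) (raagOf Λ a ^ m') :=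
          (Commute.zpow_zpow hcomm m' n).symm
        rw [zpow_add, zpow_add, mul_assoc, ← mul_assoc _ _ (raagOf Λ b ^ n'), hc.eq]
        simp only [mul_assoc]
      | inv x _ hx =>
        obtain ⟨m, n, rfl⟩ := hx
        refine ⟨-m, -n, ?_⟩
        have hc : Commute (raagOf Λ a ^ m) (raagOf Λ b ^ n) := Commute.zpow_zpow hcomm m n
        rw [hc.eq, mul_inv_rev, zpow_neg, zpow_neg]
    refine ⟨MulEquiv.ofBijective q ⟨?_, ?_⟩⟩
    · rw [injective_iff_map_eq_one]
      rintro ⟨x, hx⟩ hqx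
      obtain ⟨m, n, rfl⟩ := hform x hx
      have h1 : p (raagOf Λ a ^ m * raagOf Λ b ^ n) = 1 := hqx
      rw [hval] at h1
      have h2 : ((m, n) : ℤ × ℤ) = (0, 0) := Multiplicative.ofAdd.injective h1
      rw [Prod.mk.injEq] at h2
      obtain ⟨rfl, rfl⟩ := h2
      apply Subtype.ext
      simp
    · intro z
      refine ⟨⟨raagOf Λ a ^ z.toAdd.1 * raagOf Λ b ^ z.toAdd.2, mul_mem
        (zpow_mem (Subgroup.subset_closure (by simp)) _)
        (zpow_mem (Subgroup.subset_closure (by simp)) _)⟩, ?_⟩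
      exact hval _ _
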